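/- arXiv:2201.04187 — 7 statements merged into one kernel-verified Lean document; each statement's English description precedes it below -/
import Mathlib

section
/- Let D₁, D₂, D₃ : ℝ → ℝ³ be differentiable and suppose that for every s the triple (D₁(s), D₂(s), D₃(s)) is a right-handed orthonormal frame. Define ω(s) = ⟨D₂′(s), D₃(s)⟩ D₁(s) + ⟨D₃′(s), D₁(s)⟩ D₂(s) + ⟨D₁′(s), D₂(s)⟩ D₃(s). Then Dᵢ′(s) = ω(s) × Dᵢ(s) for i = 1, 2, 3 and every s ∈ ℝ; that is, every differentiable right-handed orthonormal frame evolves by rotation about an angular-velocity (Darboux) vector. -/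
open scoped RealInnerProductSpace

noncomputable section

/-- ℝ³ with the Euclidean inner product and norm. -/
abbrev E3 : Type := EuclideanSpace ℝ (Fin 3)

/-- The cross product on ℝ³. -/
def cross3 (u v : E3) : E3 :=
  !₂[u 1 * v 2 - u 2 * v 1, u 2 * v 0 - u 0 * v 2, u 0 * v 1 - u 1 * v 0]

/-- `(u, v, w)` is a right-handed orthonormal frame: all three are unit vectors,
pairwise orthogonal, and `u × v = w`. -/
def IsRHFrame (u v w : E3) : Prop :=
  ‖u‖ = 1 ∧ ‖v‖ = 1 ∧ ‖w‖ = 1 ∧ ⟪u, v⟫ = 0 ∧ ⟪u, w⟫ = 0 ∧ ⟪v, w⟫ = 0 ∧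
    cross3 u v = w

lemma inner3 (x y : E3) : ⟪x, y⟫ = x 0 * y 0 + x 1 * y 1 + x 2 * y 2 := by
  simp [PiLp.inner_apply, Fin.sum_univ_three]; ring

lemma frame_expand (u v w x : E3) (h : IsRHFrame u v w) :
    x = ⟪x, u⟫ • u + ⟪x, v⟫ • v + ⟪x, w⟫ • w := by
  obtain ⟨h1, h2, h3, h4, h5, h6, -⟩ := h
  have e1 : ⟪u, u⟫ = 1 := by rw [real_inner_self_eq_norm_sq, h1]; norm_num
  have e2 : ⟪v, v⟫ = 1 := by rw [real_inner_self_eq_norm_sq, h2]; norm_num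
  have e3 : ⟪w, w⟫ = 1 := by rw [real_inner_self_eq_norm_sq, h3]; norm_num
  rw [inner3] at e1 e2 e3 h4 h5 h6
  let M : Matrix (Fin 3) (Fin 3) ℝ := !![u 0, u 1, u 2; v 0, v 1, v 2; w 0, w 1, w 2]
  have hM : M * M.transpose = 1 := by
    ext i j
    fin_cases i <;> fin_cases j <;>
      simp [M, Matrix.mul_apply, Fin.sum_univ_three] <;> linarith
  have hM' : M.transpose * M = 1 := mul_eq_one_comm.mp hM
  have k := fun i j => congrFun (congrFun hM' i) j
  have k00 := k 0 0
  have k01 := k 0 1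
  have k02 := k 0 2
  have k11 := k 1 1
  have k12 := k 1 2
  have k22 := k 2 2
  simp [M, Matrix.mul_apply, Fin.sum_univ_three] at k00 k01 k02 k11 k12 k22
  ext i
  rw [inner3, inner3, inner3]
  fin_cases i <;> simp
  · linear_combination -(x 0) * k00 - x 1 * k01 - x 2 * k02
  · linear_combination -(x 0) * k01 - x 1 * k11 - x 2 * k12
  · linear_combination -(x 0) * k02 - x 1 * k12 - x 2 * k22

lemma frame_cross (u v w : E3) (h : IsRHFrame u v w) (a b c : ℝ) :
    cross3 (a • u + b • v + c • w) u = c • v - b • w ∧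
    cross3 (a • u + b • v + c • w) v = a • w - c • u ∧
    cross3 (a • u + b • v + c • w) w = b • u - a • v := by
  obtain ⟨h1, h2, h3, h4, h5, h6, hc⟩ := h
  have e1 : ⟪u, u⟫ = 1 := by rw [real_inner_self_eq_norm_sq, h1]; norm_num
  have e2 : ⟪v, v⟫ = 1 := by rw [real_inner_self_eq_norm_sq, h2]; norm_num
  rw [inner3] at e1 e2 h4
  subst hc
  refine ⟨?_, ?_, ?_⟩ <;> ext i <;> fin_cases i <;> simp [cross3]
  · linear_combination c * v 0 * e1 - c * u 0 * h4
  · linear_combination c * v 1 * e1 - c * u 1 * h4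
  · linear_combination c * v 2 * e1 - c * u 2 * h4
  · linear_combination -c * u 0 * e2 + c * v 0 * h4
  · linear_combination -c * u 1 * e2 + c * v 1 * h4
  · linear_combination -c * u 2 * e2 + c * v 2 * h4
  · linear_combination b * u 0 * e2 - b * v 0 * h4 - a * v 0 * e1 + a * u 0 * h4
  · linear_combination b * u 1 * e2 - b * v 1 * h4 - a * v 1 * e1 + a * u 1 * h4
  · linear_combination b * u 2 * e2 - b * v 2 * h4 - a * v 2 * e1 + a * u 2 * h4

lemma deriv_inner_const (f g : ℝ → E3) (hf : Differentiable ℝ f) (hg : Differentiable ℝ g)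
    (c : ℝ) (h : ∀ s, ⟪f s, g s⟫ = c) (s : ℝ) :
    ⟪deriv g s, f s⟫ = - ⟪deriv f s, g s⟫ := by
  have h1 := (hf s).hasDerivAt.inner ℝ (hg s).hasDerivAt
  have h2 : (fun s => ⟪f s, g s⟫) = fun _ => c := funext h
  rw [h2] at h1
  have h3 := h1.unique (hasDerivAt_const s c)
  rw [real_inner_comm]
  linarith

/-- Every differentiable right-handed orthonormal frame evolves by rotation about the
Darboux (angular-velocity) vector
`ω = ⟪D₂′, D₃⟫ D₁ + ⟪D₃′, D₁⟫ D₂ + ⟪D₁′, D₂⟫ D₃`. -/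
theorem darboux_vector_of_orthonormal_frame
    (D₁ D₂ D₃ : ℝ → E3)
    (hD₁ : Differentiable ℝ D₁) (hD₂ : Differentiable ℝ D₂) (hD₃ : Differentiable ℝ D₃)
    (hframe : ∀ s, IsRHFrame (D₁ s) (D₂ s) (D₃ s))
    (ω : ℝ → E3)
    (hω : ∀ s, ω s = ⟪deriv D₂ s, D₃ s⟫ • D₁ s + ⟪deriv D₃ s, D₁ s⟫ • D₂ s
        + ⟪deriv D₁ s, D₂ s⟫ • D₃ s) :
    ∀ s, deriv D₁ s = cross3 (ω s) (D₁ s) ∧ deriv D₂ s = cross3 (ω s) (D₂ s) ∧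
      deriv D₃ s = cross3 (ω s) (D₃ s) := by
  intro s
  have u1 : ∀ s, ⟪D₁ s, D₁ s⟫ = 1 := fun s => by
    rw [real_inner_self_eq_norm_sq, (hframe s).1]; norm_num
  have u2 : ∀ s, ⟪D₂ s, D₂ s⟫ = 1 := fun s => by
    rw [real_inner_self_eq_norm_sq, (hframe s).2.1]; norm_num
  have u3 : ∀ s, ⟪D₃ s, D₃ s⟫ = 1 := fun s => by
    rw [real_inner_self_eq_norm_sq, (hframe s).2.2.1]; norm_num
  have d11 : ⟪deriv D₁ s, D₁ s⟫ = 0 := by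
    have := deriv_inner_const D₁ D₁ hD₁ hD₁ 1 u1 s
    linarith
  have d22 : ⟪deriv D₂ s, D₂ s⟫ = 0 := by
    have := deriv_inner_const D₂ D₂ hD₂ hD₂ 1 u2 s
    linarith
  have d33 : ⟪deriv D₃ s, D₃ s⟫ = 0 := by
    have := deriv_inner_const D₃ D₃ hD₃ hD₃ 1 u3 s
    linarith
  have d12 := deriv_inner_const D₁ D₂ hD₁ hD₂ 0 (fun s => (hframe s).2.2.2.1) s
  have d13 := deriv_inner_const D₁ D₃ hD₁ hD₃ 0 (fun s => (hframe s).2.2.2.2.1) s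
  have d23 := deriv_inner_const D₂ D₃ hD₂ hD₃ 0 (fun s => (hframe s).2.2.2.2.2.1) s
  obtain ⟨c1, c2, c3⟩ := frame_cross _ _ _ (hframe s) ⟪deriv D₂ s, D₃ s⟫
    ⟪deriv D₃ s, D₁ s⟫ ⟪deriv D₁ s, D₂ s⟫
  rw [hω s, c1, c2, c3]
  refine ⟨?_, ?_, ?_⟩
  · refine (frame_expand _ _ _ (deriv D₁ s) (hframe s)).trans ?_
    rw [d11, d13]; module
  · refine (frame_expand _ _ _ (deriv D₂ s) (hframe s)).trans ?_
    rw [d22, d12]; module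
  · refine (frame_expand _ _ _ (deriv D₃ s) (hframe s)).trans ?_
    rw [d33, d23]; module
end
end

section
/- Let D₁, D₂, D₃ : ℝ × ℝ → ℝ³ be twice continuously differentiable in (s, t), and suppose that at every (s, t) the triple (D₁, D₂, D₃) is orthonormal. Let ω, Ω : ℝ × ℝ → ℝ³ be differentiable and satisfy ∂ₛDᵢ = ω × Dᵢ and ∂ₜDᵢ = Ω × Dᵢ for i = 1, 2, 3. Then the compatibility relation ∂ₜω = ∂ₛΩ + Ω × ω holds at every (s, t). -/
open scoped RealInnerProductSpace

noncomputable section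

/-- Partial derivative with respect to the first (arclength) variable. -/
def pderivS {E : Type*} [NormedAddCommGroup E] [NormedSpace ℝ E]
    (f : ℝ × ℝ → E) (p : ℝ × ℝ) : E :=
  deriv (fun s => f (s, p.2)) p.1

/-- Partial derivative with respect to the second (time) variable. -/
def pderivT {E : Type*} [NormedAddCommGroup E] [NormedSpace ℝ E]
    (f : ℝ × ℝ → E) (p : ℝ × ℝ) : E :=
  deriv (fun t => f (p.1, t)) p.2

lemma hasDerivAt_E3 {f : ℝ → E3} {f' : E3} {x : ℝ} :
    HasDerivAt f f' x ↔ ∀ i, HasDerivAt (fun t => f t i) (f' i) x := by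
  simp only [hasDerivAt_iff_hasFDerivAt, ← hasFDerivWithinAt_univ]
  rw [hasFDerivWithinAt_euclidean]
  refine forall_congr' fun i => ?_
  have h : (PiLp.proj 2 (fun _ : Fin 3 => ℝ) i : E3 →L[ℝ] ℝ).comp
      (ContinuousLinearMap.toSpanSingleton ℝ f') =
      ContinuousLinearMap.toSpanSingleton ℝ (f' i) := by
    ext; simp
  rw [h]

lemma HasDerivAt.cross3 {f g : ℝ → E3} {f' g' : E3} {x : ℝ}
    (hf : HasDerivAt f f' x) (hg : HasDerivAt g g' x) :
    HasDerivAt (fun t => _root_.cross3 (f t) (g t))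
      (_root_.cross3 f' (g x) + _root_.cross3 (f x) g') x := by
  rw [hasDerivAt_E3] at *
  intro i
  fin_cases i
  · exact (((hf 1).mul (hg 2)).sub ((hf 2).mul (hg 1))).congr_deriv (by simp [_root_.cross3]; ring)
  · exact (((hf 2).mul (hg 0)).sub ((hf 0).mul (hg 2))).congr_deriv (by simp [_root_.cross3]; ring)
  · exact (((hf 0).mul (hg 1)).sub ((hf 1).mul (hg 0))).congr_deriv (by simp [_root_.cross3]; ring)

lemma hasDerivAt_S {f : ℝ × ℝ → E3} {p : ℝ × ℝ} (hf : DifferentiableAt ℝ f p) :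
    HasDerivAt (fun s => f (s, p.2)) (fderiv ℝ f p (1, 0)) p.1 :=
  HasFDerivAt.comp_hasDerivAt (l := f) (f := fun s : ℝ => (s, p.2)) p.1 hf.hasFDerivAt
    ((hasDerivAt_id p.1).prodMk (hasDerivAt_const p.1 p.2))

lemma hasDerivAt_T {f : ℝ × ℝ → E3} {p : ℝ × ℝ} (hf : DifferentiableAt ℝ f p) :
    HasDerivAt (fun t => f (p.1, t)) (fderiv ℝ f p (0, 1)) p.2 :=
  HasFDerivAt.comp_hasDerivAt (l := f) (f := fun t : ℝ => (p.1, t)) p.2 hf.hasFDerivAt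
    ((hasDerivAt_const p.2 p.1).prodMk (hasDerivAt_id p.2))

lemma mixed_symm {f : ℝ × ℝ → E3} (hf : ContDiff ℝ 2 f) (p : ℝ × ℝ) :
    pderivT (pderivS f) p = pderivS (pderivT f) p := by
  have hd : Differentiable ℝ f := hf.differentiable (by norm_num)
  have hd2 : Differentiable ℝ (fderiv ℝ f) :=
    (hf.fderiv_right (m := 1) (by norm_num)).differentiable (by norm_num)
  have e1 : pderivS f = fun q => fderiv ℝ f q (1, 0) :=
    funext fun q => (hasDerivAt_S (hd q)).deriv
  have e2 : pderivT f = fun q => fderiv ℝ f q (0, 1) :=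
    funext fun q => (hasDerivAt_T (hd q)).deriv
  have k : ∀ v : ℝ × ℝ, HasFDerivAt (fun q => fderiv ℝ f q v)
      ((fderiv ℝ (fderiv ℝ f) p).flip v) p := fun v => by
    have := (hd2 p).hasFDerivAt.clm_apply (hasFDerivAt_const v p)
    simpa using this
  rw [e1, e2]
  have a := (hasDerivAt_T (k (1, 0)).differentiableAt).deriv
  have b := (hasDerivAt_S (k (0, 1)).differentiableAt).deriv
  unfold pderivT pderivS
  rw [a, b, (k _).fderiv, (k _).fderiv]
  exact (hf.contDiffAt (x := p)).isSymmSndFDerivAt (by simp) _ _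

lemma key {D ω Ω : ℝ × ℝ → E3} (hD : ContDiff ℝ 2 D)
    (hω : Differentiable ℝ ω) (hΩ : Differentiable ℝ Ω)
    (hs : ∀ p, pderivS D p = cross3 (ω p) (D p))
    (ht : ∀ p, pderivT D p = cross3 (Ω p) (D p)) (p : ℝ × ℝ) :
    cross3 (pderivT ω p - (pderivS Ω p + cross3 (Ω p) (ω p))) (D p) = 0 := by
  have hd : Differentiable ℝ D := hD.differentiable (by norm_num)
  have h := mixed_symm hD p
  rw [funext hs, funext ht] at h
  have a := ((hasDerivAt_T (hω p)).differentiableAt.hasDerivAt.cross3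
    (hasDerivAt_T (hd p)).differentiableAt.hasDerivAt).deriv
  have b := ((hasDerivAt_S (hΩ p)).differentiableAt.hasDerivAt.cross3
    (hasDerivAt_S (hd p)).differentiableAt.hasDerivAt).deriv
  have h2 : cross3 (pderivT ω p) (D p) + cross3 (ω p) (pderivT D p) =
      cross3 (pderivS Ω p) (D p) + cross3 (Ω p) (pderivS D p) := a.symm.trans (h.trans b)
  rw [hs, ht] at h2
  have h0 := congrArg (fun v : E3 => v 0) h2
  have h1 := congrArg (fun v : E3 => v 1) h2
  have h3 := congrArg (fun v : E3 => v 2) h2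
  simp [cross3] at h0 h1 h3
  ext i
  fin_cases i <;> simp [cross3] <;> linarith

lemma eq_zero_of_cross {W a b : E3} (ha : ‖a‖ = 1) (hb : ‖b‖ = 1) (hab : ⟪a, b⟫ = 0)
    (h1 : cross3 W a = 0) (h2 : cross3 W b = 0) : W = 0 := by
  have gen : ∀ c : E3, ‖c‖ = 1 → cross3 W c = 0 → W = ⟪W, c⟫ • c := by
    intro c hc h
    have h0 := congrArg (fun v : E3 => v 0) h
    have h1 := congrArg (fun v : E3 => v 1) h
    have h3 := congrArg (fun v : E3 => v 2) h
    have hn : c 0 ^ 2 + c 1 ^ 2 + c 2 ^ 2 = 1 := by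
      have := EuclideanSpace.real_norm_sq_eq c
      rw [hc, Fin.sum_univ_three] at this
      linarith
    simp [cross3] at h0 h1 h3
    ext i
    fin_cases i <;> simp [PiLp.inner_apply, Fin.sum_univ_three]
    · linear_combination (-W 0) * hn + c 1 * h3 - c 2 * h1
    · linear_combination (-W 1) * hn + c 2 * h0 - c 0 * h3
    · linear_combination (-W 2) * hn + c 0 * h1 - c 1 * h0
  have e1 := gen a ha h1
  have e2 := gen b hb h2
  have : ⟪W, b⟫ = 0 := by
    rw [e1, inner_smul_left, hab, mul_zero]
  rw [e2, this, zero_smul]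

/-- Compatibility of the spatial (Darboux) and temporal angular velocities of an
orthonormal frame: if `∂ₛDᵢ = ω × Dᵢ` and `∂ₜDᵢ = Ω × Dᵢ` for `i = 1, 2, 3`, then
`∂ₜω = ∂ₛΩ + Ω × ω`. -/
theorem frame_angular_velocity_compatibility
    (D₁ D₂ D₃ : ℝ × ℝ → E3)
    (hD₁ : ContDiff ℝ 2 D₁) (hD₂ : ContDiff ℝ 2 D₂) (hD₃ : ContDiff ℝ 2 D₃)
    (horth : ∀ p : ℝ × ℝ, ‖D₁ p‖ = 1 ∧ ‖D₂ p‖ = 1 ∧ ‖D₃ p‖ = 1 ∧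
      ⟪D₁ p, D₂ p⟫ = 0 ∧ ⟪D₁ p, D₃ p⟫ = 0 ∧ ⟪D₂ p, D₃ p⟫ = 0)
    (ω Ω : ℝ × ℝ → E3) (hω : Differentiable ℝ ω) (hΩ : Differentiable ℝ Ω)
    (hs₁ : ∀ p, pderivS D₁ p = cross3 (ω p) (D₁ p))
    (hs₂ : ∀ p, pderivS D₂ p = cross3 (ω p) (D₂ p))
    (hs₃ : ∀ p, pderivS D₃ p = cross3 (ω p) (D₃ p))
    (ht₁ : ∀ p, pderivT D₁ p = cross3 (Ω p) (D₁ p))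
    (ht₂ : ∀ p, pderivT D₂ p = cross3 (Ω p) (D₂ p))
    (ht₃ : ∀ p, pderivT D₃ p = cross3 (Ω p) (D₃ p)) :
    ∀ p : ℝ × ℝ, pderivT ω p = pderivS Ω p + cross3 (Ω p) (ω p) := by
  intro p
  obtain ⟨h1, h2, -, h12, -, -⟩ := horth p
  exact sub_eq_zero.mp (eq_zero_of_cross h1 h2 h12
    (key hD₁ hω hΩ hs₁ ht₁ p) (key hD₂ hω hΩ hs₂ ht₂ p))
end
end

section
/- Let τ, ω, Ω : ℝ × ℝ → ℝ³ be differentiable in (s, t) and satisfy ∂ₛτ = ω × τ, ∂ₜτ = Ω × τ, and the compatibility relation ∂ₜω = ∂ₛΩ + Ω × ω. Then the twist density ψ := ⟨ω, τ⟩ satisfies the evolution equation ∂ₜψ = ∂ₛ⟨Ω, τ⟩ − ⟨Ω, ∂ₛτ⟩ at every (s, t). -/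
open scoped RealInnerProductSpace

noncomputable section

/-- Evolution equation for the twist density `ψ = ⟪ω, τ⟫`: if `∂ₛτ = ω × τ`,
`∂ₜτ = Ω × τ`, and the compatibility relation `∂ₜω = ∂ₛΩ + Ω × ω` holds, then
`∂ₜψ = ∂ₛ⟪Ω, τ⟫ − ⟪Ω, ∂ₛτ⟫`. -/
theorem twist_evolution_equation
    (τ ω Ω : ℝ × ℝ → E3)
    (hτ : Differentiable ℝ τ) (hω : Differentiable ℝ ω) (hΩ : Differentiable ℝ Ω)
    (hs : ∀ p, pderivS τ p = cross3 (ω p) (τ p))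
    (ht : ∀ p, pderivT τ p = cross3 (Ω p) (τ p))
    (hcompat : ∀ p, pderivT ω p = pderivS Ω p + cross3 (Ω p) (ω p))
    (ψ : ℝ × ℝ → ℝ) (hψ : ∀ p, ψ p = ⟪ω p, τ p⟫) :
    ∀ p : ℝ × ℝ, pderivT ψ p = pderivS (fun q => ⟪Ω q, τ q⟫) p - ⟪Ω p, pderivS τ p⟫ := by
  rintro ⟨s, t⟩
  have dT : ∀ f : ℝ × ℝ → E3, Differentiable ℝ f → DifferentiableAt ℝ (fun t' => f (s, t')) t :=
    fun f hf => (hf.comp ((differentiable_const s).prodMk differentiable_id)) t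
  have dS : ∀ f : ℝ × ℝ → E3, Differentiable ℝ f → DifferentiableAt ℝ (fun s' => f (s', t)) s :=
    fun f hf => (hf.comp (differentiable_id.prodMk (differentiable_const t))) s
  have h1 : pderivT ψ (s, t) = ⟪ω (s, t), pderivT τ (s, t)⟫ + ⟪pderivT ω (s, t), τ (s, t)⟫ := by
    have e : ψ = fun q => ⟪ω q, τ q⟫ := funext hψ
    rw [e]
    exact deriv_inner_apply ℝ (dT ω hω) (dT τ hτ)
  have h2 : pderivS (fun q => ⟪Ω q, τ q⟫) (s, t)
      = ⟪Ω (s, t), pderivS τ (s, t)⟫ + ⟪pderivS Ω (s, t), τ (s, t)⟫ :=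
    deriv_inner_apply ℝ (dS Ω hΩ) (dS τ hτ)
  have h3 : ∀ a b c : E3, ⟪b, cross3 a c⟫ + ⟪cross3 a b, c⟫ = 0 := by
    intro a b c
    simp [cross3, PiLp.inner_apply, Fin.sum_univ_three]
    ring
  rw [h1, h2, hcompat, ht, inner_add_left]
  linarith [h3 (Ω (s, t)) (ω (s, t)) (τ (s, t))]
end
end

section
/- Let κ, γ ∈ ℝ, let τ : ℝ → ℝ³ be twice differentiable with ‖τ(s)‖ = 1 for all s, let ψ : ℝ → ℝ be differentiable, and let Λ : ℝ → ℝ³ be an arbitrary function. Define the internal moment N = κ (τ × τ′) + γ ψ τ and the force F = −κ τ″ + γ ψ (τ × τ′) + Λ. Then for every s, N′(s) + τ(s) × F(s) = γ ψ′(s) τ(s) + τ(s) × Λ(s). Hence with bending force F^(κ) = −κτ″ and twist force F^(γ) = γψ(τ × τ′), the elastic torque density on the fluid is purely tangential with parallel component n∥ = γψ′, and all perpendicular torque comes from the Lagrange multiplier Λ. -/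
open scoped RealInnerProductSpace

noncomputable section

/-- With the Kirchhoff internal moment `N = κ (τ × τ′) + γ ψ τ` and internal force
`F = −κ τ″ + γ ψ (τ × τ′) + Λ`, the torque density applied to the fluid is
`N′ + τ × F = γ ψ′ τ + τ × Λ`: the elastic torque is purely tangential with parallel
component `n∥ = γ ψ′`, and all perpendicular torque comes from the Lagrange
multiplier `Λ`. -/
theorem elastic_torque_is_tangential
    (κ γ : ℝ)
    (τ : ℝ → E3) (hτ : Differentiable ℝ τ) (hτ' : Differentiable ℝ (deriv τ))
    (hunit : ∀ s, ‖τ s‖ = 1)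
    (ψ : ℝ → ℝ) (hψ : Differentiable ℝ ψ)
    (Λ : ℝ → E3)
    (N F : ℝ → E3)
    (hN : ∀ s, N s = κ • cross3 (τ s) (deriv τ s) + (γ * ψ s) • τ s)
    (hF : ∀ s, F s = -κ • deriv (deriv τ) s + (γ * ψ s) • cross3 (τ s) (deriv τ s) + Λ s) :
    ∀ s, deriv N s + cross3 (τ s) (F s) = (γ * deriv ψ s) • τ s + cross3 (τ s) (Λ s) := by
  intro s
  have hco : ∀ (f : ℝ → E3) (f' : E3), HasDerivAt f f' s → ∀ i, HasDerivAt (fun x => f x i) (f' i) s := by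
    intro f f' h i
    exact ((EuclideanSpace.proj i : E3 →L[ℝ] ℝ).hasFDerivAt.comp_hasDerivAt s h)
  have h1 := hco τ _ (hτ s).hasDerivAt
  have h2 := hco (deriv τ) _ (hτ' s).hasDerivAt
  have hp := (hψ s).hasDerivAt
  have hu : ∀ x, τ x 0 * τ x 0 + τ x 1 * τ x 1 + τ x 2 * τ x 2 = 1 := by
    intro x
    have h := EuclideanSpace.real_norm_sq_eq (τ x)
    rw [hunit x, Fin.sum_univ_three] at h
    linarith
  have hd : τ s 0 * deriv τ s 0 + τ s 1 * deriv τ s 1 + τ s 2 * deriv τ s 2 = 0 := by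
    have h := (((h1 0).mul (h1 0)).add ((h1 1).mul (h1 1))).add ((h1 2).mul (h1 2))
    have h' : HasDerivAt (fun x => τ x 0 * τ x 0 + τ x 1 * τ x 1 + τ x 2 * τ x 2) 0 s := by
      simp only [hu]
      exact hasDerivAt_const s (1 : ℝ)
    have := h.unique h'
    linarith
  have hus := hu s
  have hNd : HasDerivAt N (κ • cross3 (τ s) (deriv (deriv τ) s)
      + ((γ * deriv ψ s) • τ s + (γ * ψ s) • deriv τ s)) s := by
    have hNe : N = fun s => κ • cross3 (τ s) (deriv τ s) + (γ * ψ s) • τ s := funext hN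
    rw [hNe]
    have hc : HasDerivAt (fun x => cross3 (τ x) (deriv τ x)) (cross3 (τ s) (deriv (deriv τ) s)) s := by
      suffices H : ∀ i, HasDerivAt (fun x => cross3 (τ x) (deriv τ x) i)
          (cross3 (τ s) (deriv (deriv τ) s) i) s by
        have hpi := hasDerivAt_pi.2 H
        have hl := PiLp.hasFDerivAt_toLp (𝕜 := ℝ) (E := fun _ : Fin 3 => ℝ) 2
          (cross3 (τ s) (deriv τ s)).ofLp
        exact hl.comp_hasDerivAt s hpi
      intro i
      fin_cases i
      · refine (((h1 1).mul (h2 2)).sub ((h1 2).mul (h2 1))).congr_deriv ?_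
        simp [cross3]; ring
      · refine (((h1 2).mul (h2 0)).sub ((h1 0).mul (h2 2))).congr_deriv ?_
        simp [cross3]; ring
      · refine (((h1 0).mul (h2 1)).sub ((h1 1).mul (h2 0))).congr_deriv ?_
        simp [cross3]; ring
    refine ((hc.const_smul κ).add ((hp.const_mul γ).smul (hτ s).hasDerivAt)).congr_deriv ?_
    rw [add_comm ((γ * deriv ψ s) • τ s)]
  rw [hNd.deriv, hF]
  ext i
  fin_cases i <;> simp [cross3]
  · linear_combination (γ * ψ s * τ s 0) * hd - (γ * ψ s * deriv τ s 0) * hus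
  · linear_combination (γ * ψ s * τ s 1) * hd - (γ * ψ s * deriv τ s 1) * hus
  · linear_combination (γ * ψ s * τ s 2) * hd - (γ * ψ s * deriv τ s 2) * hus
end
end

section
/- Let L > 0, let τ, λ, Ω : [0, L] → ℝ³ be continuous, and let U₀ ∈ ℝ³. Then ∫₀^L ⟨U₀ + ∫₀^s Ω(s′) × τ(s′) ds′, λ(s)⟩ ds = ⟨U₀, ∫₀^L λ(s) ds⟩ + ∫₀^L ⟨Ω(s), τ(s) × ∫ₛ^L λ(s′) ds′⟩ ds. (Thus the L² adjoint of the kinematic operator (K(U₀, Ω))(s) = U₀ + ∫₀^s Ω(s′) × τ(s′) ds′ is K*λ = (∫₀^L λ(s) ds, s ↦ τ(s) × ∫ₛ^L λ(s′) ds′).) -/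
open scoped RealInnerProductSpace

noncomputable section

theorem cross3_triple (a b c : E3) : ⟪cross3 a b, c⟫ = ⟪a, cross3 b c⟫ := by
  simp [cross3, PiLp.inner_apply, Fin.sum_univ_three]
  ring

theorem continuousOn_cross3 {s : Set ℝ} {f g : ℝ → E3} (hf : ContinuousOn f s)
    (hg : ContinuousOn g s) : ContinuousOn (fun t => cross3 (f t) (g t)) s := by
  have hc : Continuous (fun p : E3 × E3 => cross3 p.1 p.2) := by
    unfold cross3
    refine (PiLp.continuous_toLp 2 _).comp (continuous_pi fun i => ?_)
    fin_cases i <;> simp <;> fun_prop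
  exact hc.comp_continuousOn (hf.prodMk hg)

theorem adjoint_aux (L : ℝ) (w l : ℝ → E3) (hw : Continuous w) (hl : Continuous l) (U : E3) :
    ∫ s in (0:ℝ)..L, ⟪U + ∫ t in (0:ℝ)..s, w t, l s⟫
      = ⟪U, ∫ s in (0:ℝ)..L, l s⟫ + ∫ s in (0:ℝ)..L, ⟪w s, ∫ t in s..L, l t⟫ := by
  have hF : ∀ s, HasDerivAt (fun s => U + ∫ t in (0:ℝ)..s, w t) (w s) s := fun s =>
    (hw.integral_hasStrictDerivAt 0 s).hasDerivAt.const_add U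
  have hG : ∀ s, HasDerivAt (fun s => ∫ t in s..L, l t) (-l s) s := fun s =>
    intervalIntegral.integral_hasDerivAt_left (hl.intervalIntegrable _ _)
      hl.stronglyMeasurable.stronglyMeasurableAtFilter hl.continuousAt
  have cF : Continuous (fun s => U + ∫ t in (0:ℝ)..s, w t) :=
    continuous_iff_continuousAt.2 fun s => (hF s).continuousAt
  have cG : Continuous (fun s => ∫ t in s..L, l t) :=
    continuous_iff_continuousAt.2 fun s => (hG s).continuousAt
  have c1 : Continuous (fun s => ⟪U + ∫ t in (0:ℝ)..s, w t, l s⟫) := cF.inner hl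
  have c2 : Continuous (fun s => ⟪w s, ∫ t in s..L, l t⟫) := hw.inner cG
  have key := intervalIntegral.integral_eq_sub_of_hasDerivAt (a := 0) (b := L)
    (f := fun s => ⟪U + ∫ t in (0:ℝ)..s, w t, ∫ t in s..L, l t⟫)
    (f' := fun s => ⟪w s, ∫ t in s..L, l t⟫ - ⟪U + ∫ t in (0:ℝ)..s, w t, l s⟫)
    (fun s _ => by
      have := (hF s).inner ℝ (hG s)
      rw [inner_neg_right, neg_add_eq_sub] at this
      exact this)
    ((c2.sub c1).intervalIntegrable _ _)
  rw [intervalIntegral.integral_sub (c2.intervalIntegrable _ _) (c1.intervalIntegrable _ _)] at key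
  simp only [intervalIntegral.integral_same, inner_zero_right, add_zero] at key
  linarith

theorem exists_ext (L : ℝ) (hL : 0 ≤ L) (f : ℝ → E3) (hf : ContinuousOn f (Set.Icc 0 L)) :
    ∃ g : ℝ → E3, Continuous g ∧ ∀ t ∈ Set.Icc 0 L, f t = g t :=
  ⟨Set.IccExtend hL ((Set.Icc 0 L).domRestrict f), hf.domRestrict.Icc_extend',
    fun t ht => by rw [Set.IccExtend_of_mem _ _ ht]; rfl⟩

/-- The L² adjoint of the free-fiber kinematic operator
`(K(U₀, Ω))(s) = U₀ + ∫₀ˢ Ω(s′) × τ(s′) ds′` is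
`K*λ = (∫₀ᴸ λ, s ↦ τ(s) × ∫ₛᴸ λ)`:
`∫₀ᴸ ⟨K(U₀, Ω)(s), λ(s)⟩ ds = ⟨U₀, ∫₀ᴸ λ⟩ + ∫₀ᴸ ⟨Ω(s), τ(s) × ∫ₛᴸ λ⟩ ds`. -/
theorem kinematic_operator_adjoint
    (L : ℝ) (hL : 0 < L)
    (τ lam Ω : ℝ → E3)
    (hτ : ContinuousOn τ (Set.Icc 0 L))
    (hlam : ContinuousOn lam (Set.Icc 0 L))
    (hΩ : ContinuousOn Ω (Set.Icc 0 L))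
    (U₀ : E3) :
    ∫ s in (0:ℝ)..L, ⟪U₀ + ∫ t in (0:ℝ)..s, cross3 (Ω t) (τ t), lam s⟫
      = ⟪U₀, ∫ s in (0:ℝ)..L, lam s⟫
        + ∫ s in (0:ℝ)..L, ⟪Ω s, cross3 (τ s) (∫ t in s..L, lam t)⟫ := by
  obtain ⟨w, hw, hwe⟩ := exists_ext L hL.le _ (continuousOn_cross3 hΩ hτ)
  obtain ⟨l, hl, hle⟩ := exists_ext L hL.le _ hlam
  have e0 : ∫ s in (0:ℝ)..L, lam s = ∫ s in (0:ℝ)..L, l s :=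
    intervalIntegral.integral_congr fun s hs => hle s (by rwa [Set.uIcc_of_le hL.le] at hs)
  have e1 : ∫ s in (0:ℝ)..L, ⟪U₀ + ∫ t in (0:ℝ)..s, cross3 (Ω t) (τ t), lam s⟫
      = ∫ s in (0:ℝ)..L, ⟪U₀ + ∫ t in (0:ℝ)..s, w t, l s⟫ := by
    refine intervalIntegral.integral_congr fun s hs => ?_
    rw [Set.uIcc_of_le hL.le] at hs
    have : ∫ t in (0:ℝ)..s, cross3 (Ω t) (τ t) = ∫ t in (0:ℝ)..s, w t :=
      intervalIntegral.integral_congr fun t ht => by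
        rw [Set.uIcc_of_le hs.1] at ht
        exact hwe t ⟨ht.1, ht.2.trans hs.2⟩
    simp only [this, hle s hs]
  have e2 : ∫ s in (0:ℝ)..L, ⟪Ω s, cross3 (τ s) (∫ t in s..L, lam t)⟫
      = ∫ s in (0:ℝ)..L, ⟪w s, ∫ t in s..L, l t⟫ := by
    refine intervalIntegral.integral_congr fun s hs => ?_
    rw [Set.uIcc_of_le hL.le] at hs
    have : ∫ t in s..L, lam t = ∫ t in s..L, l t :=
      intervalIntegral.integral_congr fun t ht => by
        rw [Set.uIcc_of_le hs.2] at ht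
        exact hle t ⟨hs.1.trans ht.1, ht.2⟩
    simp only [this, ← hwe s hs, cross3_triple]
  rw [e0, e1, e2]
  exact adjoint_aux L w l hw hl U₀
end
end

section
/- Let L > 0, let τ : [0, L] → ℝ³ be differentiable with ‖τ(s)‖ = 1 for all s, and let λ : [0, L] → ℝ³ be continuous. Assume τ(s) × ∫ₛ^L λ(s′) ds′ = 0 for every s ∈ [0, L] and ∫₀^L λ(s) ds = 0. Define T(s) = −⟨τ(s), ∫ₛ^L λ(s′) ds′⟩. Then T is differentiable, T(0) = T(L) = 0, and λ(s) = (T τ)′(s) for every s ∈ (0, L): a force density satisfying the virtual-work constraints of the free-fiber kinematic operator admits the tension representation λ = ∂ₛ(T τ) with free-end boundary conditions on T. -/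
open scoped RealInnerProductSpace

noncomputable section

theorem aux_cross (u v : E3) (hu : ‖u‖ = 1) (h : cross3 u v = 0) : ⟪u, v⟫ • u = v := by
  have h0 : u 1 * v 2 - u 2 * v 1 = 0 := by simpa [cross3] using congrArg (fun w : E3 => w 0) h
  have h1 : u 2 * v 0 - u 0 * v 2 = 0 := by simpa [cross3] using congrArg (fun w : E3 => w 1) h
  have h2 : u 0 * v 1 - u 1 * v 0 = 0 := by simpa [cross3] using congrArg (fun w : E3 => w 2) h
  have hn : u 0 ^ 2 + u 1 ^ 2 + u 2 ^ 2 = 1 := by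
    have := EuclideanSpace.norm_sq_eq u
    rw [hu] at this
    simp [Fin.sum_univ_three] at this
    linarith
  have hi : ⟪u, v⟫ = u 0 * v 0 + u 1 * v 1 + u 2 * v 2 := by
    simp [PiLp.inner_apply, Fin.sum_univ_three]
    ring
  ext i
  rw [hi]
  fin_cases i
  · simp
    linear_combination v 0 * hn - u 2 * h1 + u 1 * h2
  · simp
    linear_combination v 1 * hn + u 2 * h0 - u 0 * h2
  · simp
    linear_combination v 2 * hn - u 1 * h0 + u 0 * h1

/-- A force density `λ` satisfying the virtual-work constraints of the free-fiber
kinematic operator, namely `τ(s) × ∫ₛᴸ λ = 0` on `[0, L]` and `∫₀ᴸ λ = 0`, admits the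
tension representation `λ = ∂ₛ(T τ)` with `T(s) = −⟨τ(s), ∫ₛᴸ λ⟩` satisfying the
free-end boundary conditions `T(0) = T(L) = 0`. -/
theorem tension_representation_of_constraint_force
    (L : ℝ) (hL : 0 < L)
    (τ : ℝ → E3) (hτ : Differentiable ℝ τ) (hunit : ∀ s ∈ Set.Icc (0:ℝ) L, ‖τ s‖ = 1)
    (lam : ℝ → E3) (hlam : Continuous lam)
    (hcross : ∀ s ∈ Set.Icc (0:ℝ) L, cross3 (τ s) (∫ t in s..L, lam t) = 0)
    (hzero : (∫ s in (0:ℝ)..L, lam s) = 0)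
    (T : ℝ → ℝ) (hT : ∀ s, T s = -⟪τ s, ∫ t in s..L, lam t⟫) :
    (∀ s ∈ Set.Icc (0:ℝ) L, DifferentiableAt ℝ T s) ∧ T 0 = 0 ∧ T L = 0 ∧
      ∀ s ∈ Set.Ioo (0:ℝ) L, lam s = deriv (fun u => T u • τ u) s := by
  have hF : ∀ s, HasDerivAt (fun s => ∫ t in s..L, lam t) (-lam s) s := fun s =>
    intervalIntegral.integral_hasDerivAt_left (hlam.intervalIntegrable _ _)
      (hlam.stronglyMeasurableAtFilter _ _) hlam.continuousAt
  have hTe : T = fun s => -⟪τ s, ∫ t in s..L, lam t⟫ := funext hT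
  refine ⟨fun s _ => ?_, ?_, ?_, fun s hs => ?_⟩
  · rw [hTe]
    exact ((hτ s).inner ℝ (hF s).differentiableAt).neg
  · rw [hT, hzero, inner_zero_right, neg_zero]
  · rw [hT, intervalIntegral.integral_same, inner_zero_right, neg_zero]
  · have he : (fun u => T u • τ u) =ᶠ[nhds s] fun u => -(∫ t in u..L, lam t) := by
      filter_upwards [Ioo_mem_nhds hs.1 hs.2] with u hu
      have hu' := Set.Ioo_subset_Icc_self hu
      rw [hT, neg_smul, aux_cross _ _ (hunit u hu') (hcross u hu')]
    rw [he.deriv_eq, (hF s).fun_neg.deriv, neg_neg]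
end
end

section
/- Let μ > 0, let X : ℝ → ℝ³ be twice continuously differentiable with ‖X′(s)‖ = 1 for all s, write τ = X′, and let f : ℝ → ℝ³ be continuously differentiable. Fix s ∈ ℝ. Then X(s′) ≠ X(s) for all s′ ≠ s sufficiently close to s, and the singularity-subtracted Stokeslet integrand g_tt(s′) = (1/(s′ − s)) [ |s′ − s| · 𝕊(X(s), X(s′)) f(s′) − (1/(8πμ)) ( f(s) + ⟨τ(s), f(s)⟩ τ(s) ) ] converges, as s′ → s with s′ ≠ s, to (1/(8πμ)) [ (1/2)( ⟨τ′(s), f(s)⟩ τ(s) + ⟨τ(s), f(s)⟩ τ′(s) ) + f′(s) + ⟨τ(s), f′(s)⟩ τ(s) ]. In particular g_tt has a removable singularity at s′ = s. -/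
open scoped RealInnerProductSpace Topology

noncomputable section

/-- The free-space Stokeslet with viscosity `μ` acting on a vector `v`:
`𝕊(x, y) v = (1/(8πμ‖x−y‖)) (v + ⟨R̂, v⟩ R̂)` with `R̂ = (x − y)/‖x − y‖`. -/
def stokeslet (μ : ℝ) (x y v : E3) : E3 :=
  (8 * Real.pi * μ * ‖x - y‖)⁻¹ •
    (v + ⟪‖x - y‖⁻¹ • (x - y), v⟫ • (‖x - y‖⁻¹ • (x - y)))

theorem stokeslet_aux (μ : ℝ) (x y v Y : E3) (k : ℝ) (hk : k ≠ 0) (h : x - y = k • Y) :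
    |k| • stokeslet μ x y v = (8 * Real.pi * μ)⁻¹ • (‖Y‖⁻¹ •
      (v + ⟪‖Y‖⁻¹ • Y, v⟫ • (‖Y‖⁻¹ • Y))) := by
  have hk' : |k| ≠ 0 := abs_ne_zero.mpr hk
  have hU : ‖k • Y‖⁻¹ • (k • Y) = (|k|⁻¹ * k) • (‖Y‖⁻¹ • Y) := by
    rw [norm_smul, Real.norm_eq_abs, mul_inv, smul_smul, smul_smul]
    congr 1; ring
  have he : (|k|⁻¹ * k) * (|k|⁻¹ * k) = 1 := by
    have : k * k = |k| * |k| := (abs_mul_abs_self k).symm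
    field_simp
    rw [sq, sq, this]
  unfold stokeslet
  rw [h, hU, real_inner_smul_left, smul_smul (_ * _) (|k|⁻¹ * k)]
  rw [show |k|⁻¹ * k * ⟪‖Y‖⁻¹ • Y, v⟫ * (|k|⁻¹ * k) = ⟪‖Y‖⁻¹ • Y, v⟫ by
    linear_combination ⟪‖Y‖⁻¹ • Y, v⟫ * he]
  generalize v + ⟪‖Y‖⁻¹ • Y, v⟫ • (‖Y‖⁻¹ • Y) = w
  rw [smul_smul, smul_smul, norm_smul, Real.norm_eq_abs]
  congr 1
  rw [mul_inv, mul_inv |k|]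
  field_simp

theorem dslope_aux (X : ℝ → E3) (hX : ContDiff ℝ 2 X) (s : ℝ) :
    HasDerivAt (dslope X s) ((1 / 2 : ℝ) • deriv (deriv X) s) s := by
  have h := taylor_tendsto (n := 2) (x₀ := s) convex_univ (Set.mem_univ s)
    (hX.contDiffOn (s := Set.univ))
  rw [nhdsWithin_univ] at h
  rw [hasDerivAt_iff_tendsto_slope]
  have h2 := (h.mono_left (nhdsWithin_le_nhds (s := {s}ᶜ))).add_const
    ((1 / 2 : ℝ) • deriv (deriv X) s)
  rw [zero_add] at h2
  refine h2.congr' ?_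
  filter_upwards [self_mem_nhdsWithin] with t ht
  have ht' : t - s ≠ 0 := sub_ne_zero.mpr ht
  rw [slope_def_module, dslope_of_ne _ ht, dslope_same, slope_def_module]
  simp only [taylorWithinEval_succ, taylor_within_zero_eval, iteratedDerivWithin_univ,
    iteratedDeriv_succ, iteratedDeriv_zero]
  match_scalars <;> simp <;> field_simp <;> norm_num

/-- The singularity-subtracted Stokeslet integrand
`g_tt(s′) = (s′ − s)⁻¹ [ |s′ − s| 𝕊(X(s), X(s′)) f(s′)
  − (1/(8πμ)) (f(s) + ⟨τ(s), f(s)⟩ τ(s)) ]`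
has a removable singularity at `s′ = s`: near (but not at) `s`, `X(s′) ≠ X(s)`, and as
`s′ → s` with `s′ ≠ s`, `g_tt(s′)` converges to
`(1/(8πμ)) [ (1/2)(⟨τ′, f⟩ τ + ⟨τ, f⟩ τ′) + f′ + ⟨τ, f′⟩ τ ]` evaluated at `s`,
where `τ = X′`. -/
theorem stokeslet_integrand_removable_singularity
    (μ : ℝ) (hμ : 0 < μ)
    (X : ℝ → E3) (hX : ContDiff ℝ 2 X) (hunit : ∀ s, ‖deriv X s‖ = 1)
    (f : ℝ → E3) (hf : ContDiff ℝ 1 f) (s : ℝ) :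
    (∀ᶠ s' in 𝓝[≠] s, X s' ≠ X s) ∧
    Filter.Tendsto
      (fun s' : ℝ => (s' - s)⁻¹ •
        (|s' - s| • stokeslet μ (X s) (X s') (f s')
          - (8 * Real.pi * μ)⁻¹ • (f s + ⟪deriv X s, f s⟫ • deriv X s)))
      (𝓝[≠] s)
      (𝓝 ((8 * Real.pi * μ)⁻¹ •
        ((1 / 2 : ℝ) • (⟪deriv (deriv X) s, f s⟫ • deriv X s
            + ⟪deriv X s, f s⟫ • deriv (deriv X) s)
          + deriv f s + ⟪deriv X s, deriv f s⟫ • deriv X s))) := by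
  have hXd : HasDerivAt X (deriv X s) s := (hX.differentiable (by norm_num) s).hasDerivAt
  have hfd : HasDerivAt f (deriv f s) s := (hf.differentiable (by norm_num) s).hasDerivAt
  have hne : deriv X s ≠ 0 := by
    intro h0
    have := hunit s
    rw [h0, norm_zero] at this
    exact zero_ne_one this
  refine ⟨hXd.eventually_ne hne, ?_⟩
  have horth : ⟪deriv X s, deriv (deriv X) s⟫ = 0 := by
    have hd : HasDerivAt (deriv X) (deriv (deriv X) s) s :=
      ((hX.differentiable_deriv_two) s).hasDerivAt
    have h1 := hd.norm_sq
    have h2 : (fun t => ‖deriv X t‖ ^ 2) = fun _ => (1 : ℝ) := by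
      funext t; rw [hunit t]; norm_num
    have h3 := h1.unique (h2 ▸ hasDerivAt_const s (1 : ℝ))
    linarith
  have hY := dslope_aux X hX s
  set Y := dslope X s with hYdef
  have hYs : Y s = deriv X s := dslope_same X s
  have hYn : ‖Y s‖ = 1 := by rw [hYs, hunit]
  have hN : HasDerivAt (fun t => ‖Y t‖⁻¹) 0 s := by
    have h1 := (hY.norm_sq.sqrt (by simp [hYn])).inv (by simp [hYn])
    have h2 : ((fun t => √(‖Y t‖ ^ 2))⁻¹) = fun t => ‖Y t‖⁻¹ := by
      funext t; simp
    have h3 : ⟪Y s, (1 / 2 : ℝ) • deriv (deriv X) s⟫ = 0 := by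
      rw [hYs, real_inner_smul_right, horth, mul_zero]
    rw [h3] at h1
    simpa [h2] using! h1
  have hU : HasDerivAt (fun t => ‖Y t‖⁻¹ • Y t) ((1 / 2 : ℝ) • deriv (deriv X) s) s := by
    simpa [hYn] using! hN.smul hY
  have hG := ((hN.smul (hfd.add ((hU.inner ℝ hfd).smul hU))).const_smul
    (8 * Real.pi * μ)⁻¹).tendsto_slope
  have hlim := Filter.Tendsto.congr' (f₂ := fun s' : ℝ => (s' - s)⁻¹ •
        (|s' - s| • stokeslet μ (X s) (X s') (f s')
          - (8 * Real.pi * μ)⁻¹ • (f s + ⟪deriv X s, f s⟫ • deriv X s))) ?_ hG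
  · convert hlim using 2
    · rfl
    simp only [Pi.smul_apply, Pi.add_apply, Pi.smul_apply', hYs, hunit, inv_one, one_smul, zero_smul, add_zero,
      real_inner_smul_left]
    congr 1
    module
  · filter_upwards [self_mem_nhdsWithin] with t ht
    have ht' : t - s ≠ 0 := sub_ne_zero.mpr ht
    have hk : X s - X t = (-(t - s)) • Y t := by
      rw [hYdef, dslope_of_ne _ ht, neg_smul, sub_smul_slope, vsub_eq_sub, neg_sub]
    have ha := stokeslet_aux μ (X s) (X t) (f t) (Y t) (-(t - s)) (neg_ne_zero.mpr ht') hk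
    rw [abs_neg] at ha
    rw [ha, slope_def_module]
    simp only [Pi.smul_apply, Pi.add_apply, Pi.smul_apply', hYs, hunit, inv_one, one_smul]
end
end
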